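/- For every integer i with 1 ≤ i ≤ 99, every j ∈ {1, 2}, and every integer k with 1 ≤ k ≤ i + j, the rational number b_{(i,j,k)} is strictly positive. -/

import Mathlib

open Finset

/-- `b i j k` from the paper, defined for `i ≥ 1` (we set `b 0 _ _ = 0`):
`b 1 j 0 = -1/j!`, `b 1 j k = (-1)^(j+1-k) * B_(j+1-k) / (j+1-k)!` for `k ≥ 1`, and for `i ≥ 2`,
`b i j k = ∑_{m=0}^{min(j, i+j-k)} ((-1)^m B_m / m!) * b (i-1) (j+1-m) k - (if k = 0 then 1/j! else 0)`.
Here `bernoulli` is Mathlib's Bernoulli number, with EGF `t/(e^t - 1)` (so `bernoulli 1 = -1/2`). -/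
def b : ℕ → ℕ → ℕ → ℚ
  | 0, _, _ => 0
  | 1, j, k =>
      if k = 0 then -(1 / (Nat.factorial j : ℚ))
      else (-1) ^ (j + 1 - k) * bernoulli (j + 1 - k) / (Nat.factorial (j + 1 - k) : ℚ)
  | (i + 2), j, k =>
      (∑ m ∈ Finset.range (min j (i + 2 + j - k) + 1),
        ((-1) ^ m * bernoulli m / (Nat.factorial m : ℚ)) * b (i + 1) (j + 1 - m) k)
      - (if k = 0 then 1 / (Nat.factorial j : ℚ) else 0)

open PowerSeries in
/-- The series `1 - exp (-X)`. -/
noncomputable def oneSubExpNeg : PowerSeries ℚ := 1 - evalNegHom (exp ℚ)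

open PowerSeries in
/-- Iterates of `f ↦ f / (1 - exp (-X)) - (its constant coefficient)` started at `X ^ k`
(and at `0` for `k = 0`). -/
noncomputable def iterSeries (k : ℕ) : ℕ → PowerSeries ℚ
  | 0 => if k = 0 then 0 else X ^ k
  | i + 1 => mk fun j => if j = 0 then 0 else
      coeff (j + 1) (bernoulli'PowerSeries ℚ * iterSeries k i)

section IterSeries

open PowerSeries

lemma coeff_bernoulli'PowerSeries (m : ℕ) :
    coeff m (bernoulli'PowerSeries ℚ) = (-1) ^ m * bernoulli m / (Nat.factorial m : ℚ) := by
  have h : ((-1 : ℚ) ^ m * (-1) ^ m) = 1 := by rw [← mul_pow]; simp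
  simp [bernoulli'PowerSeries, bernoulli, ← mul_assoc, h]

lemma bernoulli'PowerSeries_mul_oneSubExpNeg :
    bernoulli'PowerSeries ℚ * oneSubExpNeg = X := by
  have h := bernoulli'PowerSeries_mul_exp_sub_one ℚ
  have e := exp_mul_exp_neg_eq_one (A := ℚ)
  unfold oneSubExpNeg
  linear_combination (evalNegHom (exp ℚ)) * h + (X - bernoulli'PowerSeries ℚ) * e

lemma derivative_oneSubExpNeg :
    derivative ℚ oneSubExpNeg = 1 - oneSubExpNeg := by
  ext n
  have h : ((n : ℚ) + 1) ≠ 0 := by positivity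
  simp [oneSubExpNeg, coeff_derivative, evalNegHom, coeff_rescale, coeff_exp,
    Nat.factorial_succ, pow_succ]
  field_simp

lemma coeff_zero_oneSubExpNeg : coeff 0 oneSubExpNeg = 0 := by
  simp [oneSubExpNeg, evalNegHom, coeff_rescale, coeff_exp, -coeff_zero_eq_constantCoeff]

lemma coeff_one_oneSubExpNeg : coeff 1 oneSubExpNeg = 1 := by
  simp [oneSubExpNeg, evalNegHom, coeff_rescale, coeff_exp, coeff_one]

lemma oneSubExpNeg_ne_zero : oneSubExpNeg ≠ 0 := by
  intro h
  have := coeff_one_oneSubExpNeg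
  simp [h] at this

lemma coeff_zero_iterSeries (k i : ℕ) : coeff 0 (iterSeries k i) = 0 := by
  cases i with
  | zero =>
    by_cases hk : k = 0
    · simp [iterSeries, hk]
    · simp [iterSeries, hk, Ne.symm hk]
  | succ i => simp [iterSeries, -coeff_zero_eq_constantCoeff]

lemma coeff_mul_iterSeries (k i n : ℕ) :
    coeff n (bernoulli'PowerSeries ℚ * iterSeries k i) =
      ∑ m ∈ Finset.range (n + 1),
        ((-1) ^ m * bernoulli m / (Nat.factorial m : ℚ)) * coeff (n - m) (iterSeries k i) := by
  rw [coeff_mul, Finset.Nat.sum_antidiagonal_eq_sum_range_succ_mk]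
  simp [coeff_bernoulli'PowerSeries]

lemma X_mul_iterSeries_succ (k i : ℕ) :
    X * iterSeries k (i + 1) =
      bernoulli'PowerSeries ℚ * iterSeries k i - C (coeff 1 (iterSeries k i)) * X := by
  ext n
  rcases n with _ | _ | n
  · rw [map_sub, coeff_mul_iterSeries]
    simp only [coeff_zero_X_mul, coeff_zero_mul_X, zero_add, Finset.sum_range_one,
      Nat.sub_self, coeff_zero_iterSeries, mul_zero, sub_zero]
  · rw [map_sub, coeff_mul_iterSeries, coeff_succ_X_mul, coeff_succ_mul_X,
      coeff_zero_iterSeries]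
    simp only [zero_add, Finset.sum_range_succ, Finset.sum_range_zero, Nat.sub_self,
      coeff_zero_iterSeries]
    simp
  · rw [map_sub, coeff_succ_X_mul, coeff_succ_mul_X]
    simp [iterSeries]

lemma iterSeries_eq (k i : ℕ) :
    iterSeries k i =
      oneSubExpNeg * (iterSeries k (i + 1) + C (coeff 1 (iterSeries k i))) := by
  have h := X_mul_iterSeries_succ k i
  have hS := bernoulli'PowerSeries_mul_oneSubExpNeg
  apply mul_left_cancel₀ (X_ne_zero (R := ℚ))
  linear_combination -oneSubExpNeg * h - iterSeries k i * hS

lemma coeff_one_iterSeries_succ (k i : ℕ) :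
    coeff 1 (iterSeries k (i + 1)) =
      coeff 2 (iterSeries k i) + 1 / 2 * coeff 1 (iterSeries k i) := by
  have h : coeff 1 (iterSeries k (i + 1)) =
      coeff 2 (bernoulli'PowerSeries ℚ * iterSeries k i) := by simp [iterSeries]
  rw [h, coeff_mul_iterSeries]
  simp [Finset.sum_range_succ, coeff_zero_iterSeries, bernoulli_one,
    -coeff_zero_eq_constantCoeff]
  ring

lemma iterSeries_zero_left (i : ℕ) : iterSeries 0 i = 0 := by
  induction i with
  | zero => simp [iterSeries]
  | succ i ih => ext n; simp [iterSeries, ih]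

/-- Extracting the linear coefficient of the differential equation below. -/
lemma coeff_one_of_derivative_eq {F G : PowerSeries ℚ} {t c d : ℚ}
    (hF : coeff 0 F = 0) (hG : coeff 0 G = 0)
    (h : oneSubExpNeg * derivative ℚ F + C t * (1 - oneSubExpNeg) * F =
      C d * oneSubExpNeg * G + C c * oneSubExpNeg) :
    (t + 1) * coeff 1 F = c := by
  have h1 := congrArg (coeff 1) h
  have hS0 := coeff_zero_oneSubExpNeg
  have hS1 := coeff_one_oneSubExpNeg
  simp [mul_assoc, coeff_mul, Finset.Nat.antidiagonal_succ,
    coeff_derivative, hS1, -coeff_zero_eq_constantCoeff, hF, hG, hS0, sub_mul] at h1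
  linear_combination h1

lemma derivative_iterSeries (k i : ℕ) :
    oneSubExpNeg * derivative ℚ (iterSeries (k + 1) i) +
        C (i : ℚ) * (1 - oneSubExpNeg) * iterSeries (k + 1) i =
      C ((k : ℚ) + 1) * oneSubExpNeg * iterSeries k i +
        C (((i : ℚ) + 1) * coeff 1 (iterSeries (k + 1) i)) * oneSubExpNeg ∧
    ((i : ℚ) + 2) * coeff 1 (iterSeries (k + 1) (i + 1)) =
      ((k : ℚ) + 1) * coeff 1 (iterSeries k i) +
        ((i : ℚ) + 1) * coeff 1 (iterSeries (k + 1) i) := by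
  have step : ∀ i : ℕ, oneSubExpNeg * derivative ℚ (iterSeries (k + 1) i) +
        C (i : ℚ) * (1 - oneSubExpNeg) * iterSeries (k + 1) i =
      C ((k : ℚ) + 1) * oneSubExpNeg * iterSeries k i +
        C (((i : ℚ) + 1) * coeff 1 (iterSeries (k + 1) i)) * oneSubExpNeg →
      oneSubExpNeg * derivative ℚ (iterSeries (k + 1) (i + 1)) +
        C ((i : ℚ) + 1) * (1 - oneSubExpNeg) * iterSeries (k + 1) (i + 1) =
      C ((k : ℚ) + 1) * oneSubExpNeg * iterSeries k (i + 1) +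
        C (((k : ℚ) + 1) * coeff 1 (iterSeries k i) +
          ((i : ℚ) + 1) * coeff 1 (iterSeries (k + 1) i)) * oneSubExpNeg := by
    intro i h
    have e1 := iterSeries_eq (k + 1) i
    have e2 := iterSeries_eq k i
    have e3 := congrArg (derivative ℚ) e1
    simp only [Derivation.leibniz, smul_eq_mul, map_add, derivative_C,
      derivative_oneSubExpNeg, add_zero] at e3
    apply mul_left_cancel₀ oneSubExpNeg_ne_zero
    simp only [map_add, map_mul, map_one] at h ⊢
    linear_combination h - oneSubExpNeg * e3 - C (i : ℚ) * (1 - oneSubExpNeg) * e1 +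
      (C (k : ℚ) + 1) * oneSubExpNeg * e2
  have recur : ∀ i : ℕ, oneSubExpNeg * derivative ℚ (iterSeries (k + 1) i) +
        C (i : ℚ) * (1 - oneSubExpNeg) * iterSeries (k + 1) i =
      C ((k : ℚ) + 1) * oneSubExpNeg * iterSeries k i +
        C (((i : ℚ) + 1) * coeff 1 (iterSeries (k + 1) i)) * oneSubExpNeg →
      ((i : ℚ) + 2) * coeff 1 (iterSeries (k + 1) (i + 1)) =
      ((k : ℚ) + 1) * coeff 1 (iterSeries k i) +
        ((i : ℚ) + 1) * coeff 1 (iterSeries (k + 1) i) := by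
    intro i h
    have := coeff_one_of_derivative_eq (coeff_zero_iterSeries _ _)
      (coeff_zero_iterSeries _ _) (step i h)
    linear_combination this
  suffices h : _ from ⟨h, recur i h⟩
  induction i with
  | zero =>
    rcases k with _ | k
    · simp [iterSeries]
    · simp [iterSeries, coeff_X_pow, Derivation.leibniz_pow]
      ring
  | succ i ih =>
    have h1 := step i ih
    rw [← recur i ih] at h1
    push_cast
    rw [h1]
    congr 4
    ring

lemma coeff_one_iterSeries_nonneg (k i : ℕ) : 0 ≤ coeff 1 (iterSeries k i) := by
  induction i generalizing k with
  | zero =>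
    simp only [iterSeries]
    split_ifs
    · simp
    · rw [coeff_X_pow]; split_ifs <;> simp
  | succ i ih =>
    rcases k with _ | k
    · simp [iterSeries_zero_left]
    · have h := (derivative_iterSeries k i).2
      have h1 := ih k
      have h2 := ih (k + 1)
      have h3 : 0 ≤ ((i : ℚ) + 2) * coeff 1 (iterSeries (k + 1) (i + 1)) := by
        rw [h]; positivity
      exact nonneg_of_mul_nonneg_right h3 (by positivity)

lemma coeff_one_iterSeries_pos {k i : ℕ} (hk : 1 ≤ k) (hki : k ≤ i + 1) :
    0 < coeff 1 (iterSeries k i) := by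
  induction i generalizing k with
  | zero =>
    obtain rfl : k = 1 := by omega
    simp [iterSeries]
  | succ i ih =>
    obtain ⟨k, rfl⟩ : ∃ l, k = l + 1 := ⟨k - 1, by omega⟩
    have h := (derivative_iterSeries k i).2
    have h1 := coeff_one_iterSeries_nonneg k i
    have h2 := coeff_one_iterSeries_nonneg (k + 1) i
    have h3 : 0 < ((i : ℚ) + 2) * coeff 1 (iterSeries (k + 1) (i + 1)) := by
      rw [h]
      rcases Nat.lt_or_ge k (i + 1) with hlt | hge
      · have := ih (k := k + 1) (by omega) (by omega)
        positivity
      · have := ih (k := k) (by omega) (by omega)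
        positivity
    exact pos_of_mul_pos_right h3 (by positivity)

lemma coeff_two_iterSeries_pos {k i : ℕ} (hi : 1 ≤ i) (hk : 1 ≤ k) (hki : k ≤ i + 2) :
    0 < coeff 2 (iterSeries k i) := by
  obtain ⟨k, rfl⟩ : ∃ l, k = l + 1 := ⟨k - 1, by omega⟩
  have h := (derivative_iterSeries k i).2
  rw [coeff_one_iterSeries_succ] at h
  have h1 := coeff_one_iterSeries_nonneg k i
  have h2 := coeff_one_iterSeries_nonneg (k + 1) i
  have h3 : ((i : ℚ) + 2) * coeff 2 (iterSeries (k + 1) i) =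
      ((k : ℚ) + 1) * coeff 1 (iterSeries k i) +
        (i : ℚ) / 2 * coeff 1 (iterSeries (k + 1) i) := by
    linear_combination h
  have h4 : 0 < ((i : ℚ) + 2) * coeff 2 (iterSeries (k + 1) i) := by
    rw [h3]
    have hi' : (0 : ℚ) < i := by exact_mod_cast hi
    rcases Nat.lt_or_ge k (i + 1) with hlt | hge
    · have := coeff_one_iterSeries_pos (k := k + 1) (i := i) (by omega) (by omega)
      positivity
    · have := coeff_one_iterSeries_pos (k := k) (i := i) (by omega) (by omega)
      positivity
  exact pos_of_mul_pos_right h4 (by positivity)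

lemma coeff_iterSeries_eq_zero {k i j : ℕ} (h : i + j < k) :
    coeff j (iterSeries k i) = 0 := by
  induction i generalizing j with
  | zero =>
    have hk : k ≠ 0 := by omega
    simp [iterSeries, hk, coeff_X_pow]
    omega
  | succ i ih =>
    simp only [iterSeries, coeff_mk, coeff_mul_iterSeries]
    split_ifs
    · rfl
    · refine Finset.sum_eq_zero fun m _ => ?_
      rw [ih (by omega), mul_zero]

lemma b_eq_coeff_iterSeries {i j k : ℕ} (hj : 1 ≤ j) (hk : 1 ≤ k) (h : k ≤ i + 1 + j) :
    b (i + 1) j k = coeff j (iterSeries k (i + 1)) := by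
  have hk0 : k ≠ 0 := by omega
  have hj0 : j ≠ 0 := by omega
  induction i generalizing j with
  | zero =>
    have hkj : k ≤ j + 1 := by omega
    simp [b, iterSeries, hk0, hj0, coeff_mul_X_pow', hkj, coeff_bernoulli'PowerSeries]
  | succ i ih =>
    simp only [b, hk0, if_false, sub_zero]
    rw [iterSeries, coeff_mk, if_neg hj0, coeff_mul_iterSeries]
    have hsub : Finset.range (min j (i + 2 + j - k) + 1) ⊆ Finset.range (j + 1 + 1) := by
      intro m hm
      simp only [Finset.mem_range] at *
      omega
    rw [← Finset.sum_subset hsub]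
    · refine Finset.sum_congr rfl fun m hm => ?_
      simp only [Finset.mem_range] at hm
      rw [ih (by omega) (by omega) (by omega)]
    · intro m hm hm'
      simp only [Finset.mem_range] at hm hm'
      rcases Nat.lt_or_ge j m with hlt | hge
      · rw [show j + 1 - m = 0 by omega, coeff_zero_iterSeries, mul_zero]
      · rw [coeff_iterSeries_eq_zero (by omega), mul_zero]

end IterSeries

/-- For every integer `1 ≤ i ≤ 99`, every `j ∈ {1, 2}`, and every
integer `k` with `1 ≤ k ≤ i + j`, the rational number `b i j k` is strictly positive. -/
theorem b_pos (i j k : ℕ) (hi₁ : 1 ≤ i) (hi₂ : i ≤ 99) (hj : j = 1 ∨ j = 2)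
    (hk₁ : 1 ≤ k) (hk₂ : k ≤ i + j) :
    0 < b i j k := by
  obtain ⟨i, rfl⟩ : ∃ l, i = l + 1 := ⟨i - 1, by omega⟩
  rw [b_eq_coeff_iterSeries (by omega) hk₁ hk₂]
  rcases hj with rfl | rfl
  · exact coeff_one_iterSeries_pos hk₁ hk₂
  · exact coeff_two_iterSeries_pos hi₁ hk₁ hk₂
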